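/- arXiv:1912.03741 — 14 statements merged into one kernel-verified Lean document; each statement's English description precedes it below -/
import Mathlib

section
/- Let G be a finite abelian group with |G| ≥ 3 and let x ∈ C(G) be a point satisfying x(h) > 0 for every nonzero h ∈ G. Define a relation ⪯ on G by: a ⪯ b if and only if a = b, or (b ≠ 0 and x(a) + x(b − a) = x(b)). Then ⪯ is a partial order on G (reflexive, antisymmetric, and transitive) with unique minimal element 0, and it is Kunz-balanced: for all a, b ∈ G, a ⪯ b implies b − a ⪯ b. -/
/-- The group cone `C(G)`: functions `x : G → ℝ` with `x 0 = 0` and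
`x a + x b ≥ x (a + b)` for all nonzero `a b` with `a + b ≠ 0`. -/
def InGroupCone {G : Type*} [AddCommGroup G] (x : G → ℝ) : Prop :=
  x 0 = 0 ∧ ∀ a b : G, a ≠ 0 → b ≠ 0 → a + b ≠ 0 → x (a + b) ≤ x a + x b

/-- The relation `a ⪯ b` induced by a point `x` of the group cone. -/
def coneLe {G : Type*} [AddCommGroup G] (x : G → ℝ) (a b : G) : Prop :=
  a = b ∨ (b ≠ 0 ∧ x a + x (b - a) = x b)

theorem stmt0 {G : Type*} [AddCommGroup G] [Fintype G]
    (hG : 3 ≤ Fintype.card G) (x : G → ℝ) (hx : InGroupCone x)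
    (hpos : ∀ h : G, h ≠ 0 → 0 < x h) :
    (∀ a : G, coneLe x a a) ∧
    (∀ a b : G, coneLe x a b → coneLe x b a → a = b) ∧
    (∀ a b c : G, coneLe x a b → coneLe x b c → coneLe x a c) ∧
    (∀ b : G, coneLe x 0 b) ∧
    (∀ a b : G, coneLe x a b → coneLe x (b - a) b) := by
  obtain ⟨h0, hs⟩ := hx
  have hnn : ∀ a, 0 ≤ x a := by
    intro a
    by_cases h : a = 0
    · rw [h, h0]
    · exact (hpos a h).le
  have sub : ∀ a b, x (a + b) ≤ x a + x b := by
    intro a b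
    by_cases ha : a = 0
    · simp [ha, h0]
    by_cases hb : b = 0
    · simp [hb, h0]
    by_cases hab : a + b = 0
    · rw [hab, h0]
      exact add_nonneg (hnn a) (hnn b)
    exact hs a b ha hb hab
  have hbot : ∀ b, coneLe x 0 b := by
    intro b
    by_cases hb : b = 0
    · exact Or.inl hb.symm
    · exact Or.inr ⟨hb, by simp [h0]⟩
  refine ⟨fun a => Or.inl rfl, ?_, ?_, hbot, ?_⟩
  · rintro a b (h | ⟨hb, h⟩) (h' | ⟨ha, h'⟩)
    · exact h
    · exact h
    · exact h'.symm
    · by_contra hne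
      have h1 := hpos (b - a) (sub_ne_zero.mpr (Ne.symm hne))
      have h2 := hnn (a - b)
      linarith
  · rintro a b c (rfl | ⟨hb, h⟩) h'
    · exact h'
    · rcases h' with rfl | ⟨hc, h'⟩
      · exact Or.inr ⟨hb, h⟩
      · refine Or.inr ⟨hc, ?_⟩
        have h1 := sub a (c - a)
        have h2 := sub (b - a) (c - b)
        rw [show a + (c - a) = c by abel] at h1
        rw [show (b - a) + (c - b) = c - a by abel] at h2
        linarith
  · rintro a b (rfl | ⟨hb, h⟩)
    · rw [sub_self]
      exact hbot a
    · refine Or.inr ⟨hb, ?_⟩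
      rw [sub_sub_cancel]
      linarith
end

section
/- Let G be a finite abelian group with |G| ≥ 3 and let x ∈ C(G). Then the set H = {h ∈ G : x(h) = 0} is a subgroup of G, and x(a + h) = x(a) for every a ∈ G and every h ∈ H. -/
theorem cone_neg_le {G : Type*} [AddCommGroup G] [Fintype G]
    (x : G → ℝ) (hx : InGroupCone x) (a : G) (ha : a ≠ 0) :
    x (-a) ≤ ((Fintype.card G : ℝ) - 1) * x a := by
  classical
  obtain ⟨h0, h⟩ := hx
  have key : ∑ b : G, x (a + b) ≤
      ∑ b : G, (x a + x b - if b = -a then x a + x (-a) else 0) := by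
    apply Finset.sum_le_sum
    intro b _
    split_ifs with hb
    · subst hb
      simp [h0]
    · by_cases hb0 : b = 0
      · subst hb0
        simp [h0]
      · have := h a b ha hb0 (fun e => hb (eq_neg_of_add_eq_zero_right e))
        linarith
  have e : ∑ b : G, x (a + b) = ∑ b : G, x b := Equiv.sum_comp (Equiv.addLeft a) x
  rw [e, Finset.sum_sub_distrib, Finset.sum_add_distrib, Finset.sum_ite_eq'] at key
  simp at key
  linarith

theorem cone_nonneg {G : Type*} [AddCommGroup G] [Fintype G]
    (hG : 3 ≤ Fintype.card G) (x : G → ℝ) (hx : InGroupCone x) (a : G) : 0 ≤ x a := by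
  by_cases ha : a = 0
  · rw [ha, hx.1]
  have h1 := cone_neg_le x hx a ha
  have h2 := cone_neg_le x hx (-a) (neg_ne_zero.mpr ha)
  rw [neg_neg] at h2
  have hN : (3 : ℝ) ≤ Fintype.card G := by exact_mod_cast hG
  by_contra! hn
  have h3 : x (-a) ≤ 2 * x a := by nlinarith
  have h4 : x a ≤ 2 * x (-a) := by nlinarith
  linarith

theorem stmt1 {G : Type*} [AddCommGroup G] [Fintype G]
    (hG : 3 ≤ Fintype.card G) (x : G → ℝ) (hx : InGroupCone x) :
    (∃ H : AddSubgroup G, (H : Set G) = {h : G | x h = 0}) ∧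
    (∀ a h : G, x h = 0 → x (a + h) = x a) := by
  have hneg : ∀ h, x h = 0 → x (-h) = 0 := by
    intro h hh
    by_cases h0 : h = 0
    · rw [h0, neg_zero, hx.1]
    have h1 := cone_neg_le x hx h h0
    rw [hh, mul_zero] at h1
    exact le_antisymm h1 (cone_nonneg hG x hx _)
  have hle : ∀ a h, x h = 0 → x (a + h) ≤ x a := by
    intro a h hh
    by_cases ha : a = 0
    · rw [ha, zero_add, hh, hx.1]
    by_cases h0 : h = 0
    · rw [h0, add_zero]
    by_cases hs : a + h = 0
    · rw [hs, hx.1]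
      exact cone_nonneg hG x hx a
    have := hx.2 a h ha h0 hs
    linarith
  have heq : ∀ a h, x h = 0 → x (a + h) = x a := by
    intro a h hh
    refine le_antisymm (hle a h hh) ?_
    have := hle (a + h) (-h) (hneg h hh)
    rwa [add_neg_cancel_right] at this
  refine ⟨⟨{ carrier := {h : G | x h = 0}, zero_mem' := hx.1, add_mem' := ?_, neg_mem' := ?_ }, rfl⟩, heq⟩
  · intro a b ha hb
    exact (heq a b hb).trans ha
  · intro a ha
    exact hneg a ha
end

section
/- Let G be a finite abelian group with |G| ≥ 3, let x ∈ C(G), and let a, b ∈ G be nonzero elements with a + b ≠ 0. If x(a) + x(b) = x(a + b) and x(a + b) + x(−b) = x(a), then x(b) = 0 and x(−b) = 0. -/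
theorem InGroupCone.neg_aux {G : Type*} [AddCommGroup G] [Fintype G] (x : G → ℝ)
    (hx : InGroupCone x) (b : G) (hb : b ≠ 0) :
    ∃ k : ℕ, x (-b) ≤ (k : ℝ) * x b := by
  have key : ∀ k : ℕ, k + 1 < addOrderOf b → x ((k + 1) • b) ≤ ((k + 1 : ℕ) : ℝ) * x b := by
    intro k
    induction k with
    | zero => intro _; simp
    | succ k ih =>
      intro hk
      have h0 : ∀ m : ℕ, m ≠ 0 → m < addOrderOf b → m • b ≠ 0 := fun m h h' =>
        nsmul_ne_zero_of_lt_addOrderOf h h'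
      have h1 := ih (by omega)
      have h2 := hx.2 ((k + 1) • b) b (h0 _ (by omega) (by omega)) hb
        (by rw [← succ_nsmul]; exact h0 _ (by omega) hk)
      rw [← succ_nsmul] at h2
      push_cast at h1 ⊢
      linarith
  have hpos : 0 < addOrderOf b := addOrderOf_pos b
  have hne : addOrderOf b ≠ 1 := by
    rw [Ne, AddMonoid.addOrderOf_eq_one_iff]; exact hb
  obtain ⟨k, hk⟩ : ∃ k, addOrderOf b = k + 2 := ⟨addOrderOf b - 2, by omega⟩
  refine ⟨k + 1, ?_⟩
  have h := key k (by omega)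
  have e : (k + 1) • b = -b := by
    have h3 := addOrderOf_nsmul_eq_zero b
    rw [hk, succ_nsmul] at h3
    exact eq_neg_of_add_eq_zero_left h3
  rwa [e] at h

theorem stmt2 {G : Type*} [AddCommGroup G] [Fintype G]
    (hG : 3 ≤ Fintype.card G) (x : G → ℝ) (hx : InGroupCone x)
    (a b : G) (ha : a ≠ 0) (hb : b ≠ 0) (hab : a + b ≠ 0)
    (h1 : x a + x b = x (a + b)) (h2 : x (a + b) + x (-b) = x a) :
    x b = 0 ∧ x (-b) = 0 := by
  obtain ⟨k, hk⟩ := hx.neg_aux x b hb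
  obtain ⟨m, hm⟩ := hx.neg_aux x (-b) (neg_ne_zero.mpr hb)
  rw [neg_neg] at hm
  have hs : x (-b) = -x b := by linarith
  rw [hs] at hk hm
  have hk0 : (0 : ℝ) ≤ k := Nat.cast_nonneg k
  have hm0 : (0 : ℝ) ≤ m := Nat.cast_nonneg m
  have : x b = 0 := by
    apply le_antisymm
    · by_contra! h
      nlinarith
    · by_contra! h
      nlinarith
  exact ⟨this, by rw [hs, this, neg_zero]⟩
end

section
/- Let G be a finite abelian group, let x ∈ C(G), and let a, b, c ∈ G be pairwise distinct nonzero elements. If x(a) + x(b − a) = x(b) and x(b) + x(c − b) = x(c), then x(a) + x(c − a) = x(c). -/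
theorem stmt3 {G : Type*} [AddCommGroup G] [Fintype G]
    (x : G → ℝ) (hx : InGroupCone x)
    (a b c : G) (ha : a ≠ 0) (hb : b ≠ 0) (hc : c ≠ 0)
    (hab : a ≠ b) (hbc : b ≠ c) (hac : a ≠ c)
    (h1 : x a + x (b - a) = x b) (h2 : x b + x (c - b) = x c) :
    x a + x (c - a) = x c := by
  have e1 := hx.2 (b - a) (c - b) (sub_ne_zero.2 hab.symm) (sub_ne_zero.2 hbc.symm)
    (by rw [add_comm, sub_add_sub_cancel]; exact sub_ne_zero.2 hac.symm)
  rw [add_comm (b - a), sub_add_sub_cancel] at e1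
  have e2 := hx.2 a (c - a) ha (sub_ne_zero.2 hac.symm) (by rwa [add_sub_cancel])
  rw [add_sub_cancel] at e2
  linarith
end

section
/- Let G be a finite abelian group with |G| ≥ 3 and let x ∈ C(G) satisfy x(h) > 0 for every nonzero h ∈ G. Define a ⪯ b if and only if a = b, or (b ≠ 0 and x(a) + x(b − a) = x(b)), and write a ≺ b when a ⪯ b and a ≠ b. Let M = {m ∈ G : m ≠ 0 and there is no c ∈ G with 0 ≺ c ≺ m} (the set of atoms of ⪯). Then for all a, b ∈ G with a ≺ b, the element b covers a (that is, there is no c ∈ G with a ≺ c ≺ b) if and only if b − a ∈ M. -/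
/-- The strict relation `a ≺ b` induced by a point `x` of the group cone. -/
def coneLt {G : Type*} [AddCommGroup G] (x : G → ℝ) (a b : G) : Prop :=
  coneLe x a b ∧ a ≠ b

theorem stmt6 {G : Type*} [AddCommGroup G] [Fintype G]
    (hG : 3 ≤ Fintype.card G) (x : G → ℝ) (hx : InGroupCone x)
    (hpos : ∀ h : G, h ≠ 0 → 0 < x h)
    (a b : G) (hab : coneLt x a b) :
    (¬ ∃ c : G, coneLt x a c ∧ coneLt x c b) ↔
      (b - a ≠ 0 ∧ ¬ ∃ c : G, coneLt x 0 c ∧ coneLt x c (b - a)) := by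
  obtain ⟨h0, hsub⟩ := hx
  have hnn : ∀ g : G, 0 ≤ x g := by
    intro g
    by_cases hg : g = 0
    · rw [hg, h0]
    · exact (hpos g hg).le
  have sub : ∀ u v : G, x (u + v) ≤ x u + x v := by
    intro u v
    by_cases hu : u = 0
    · simp [hu, h0]
    by_cases hv : v = 0
    · simp [hv, h0]
    by_cases huv : u + v = 0
    · rw [huv, h0]
      exact add_nonneg (hnn u) (hnn v)
    exact hsub u v hu hv huv
  have lt_iff : ∀ u v : G, coneLt x u v ↔ (u ≠ v ∧ v ≠ 0 ∧ x u + x (v - u) = x v) := by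
    intro u v
    unfold coneLt coneLe
    tauto
  rw [lt_iff] at hab
  obtain ⟨hne, hb, hE⟩ := hab
  have hba : b - a ≠ 0 := sub_ne_zero.mpr (Ne.symm hne)
  simp only [lt_iff]
  rw [and_iff_right hba, not_iff_not]
  constructor
  · rintro ⟨c, ⟨hac, hc, e1⟩, hcb, -, e2⟩
    refine ⟨c - a, ⟨(sub_ne_zero.mpr hac.symm).symm, sub_ne_zero.mpr hac.symm, ?_⟩, ?_, hba, ?_⟩
    · simp [h0]
    · intro h
      exact hcb (sub_left_injective h)
    · rw [sub_sub_sub_cancel_right]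
      linarith
  · rintro ⟨d, ⟨hd, -, -⟩, hdb, -, e⟩
    have hdpos := hpos d hd.symm
    have s1 := sub a d
    have s2 := sub (a + d) (b - (a + d))
    rw [add_sub_cancel] at s2
    rw [sub_sub] at e
    have hc : a + d ≠ 0 := by
      intro h
      rw [h, sub_zero] at e
      have := hnn a
      linarith
    refine ⟨a + d, ⟨?_, hc, ?_⟩, ?_, hb, ?_⟩
    · intro h
      exact hd.symm (by simpa using h)
    · rw [add_sub_cancel_left]
      linarith
    · intro h
      exact hdb (by rw [← h, add_sub_cancel_left])
    · linarith
end

section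
/- Let G be a finite abelian group with |G| ≥ 3 and let x ∈ C(G) satisfy x(h) > 0 for every nonzero h ∈ G. Define a ⪯ b if and only if a = b, or (b ≠ 0 and x(a) + x(b − a) = x(b)), and let M = {m ∈ G : m ≠ 0 and there is no c ∈ G with c ≠ 0, c ≠ m, and c ⪯ m} (the set of atoms of ⪯). Suppose y, z ∈ C(G) both satisfy every equality that x satisfies, i.e., for all a, b ∈ G with a ⪯ b and a ≠ b one has y(a) + y(b − a) = y(b) and z(a) + z(b − a) = z(b). If y(m) = z(m) for every m ∈ M, then y = z. -/
theorem stmt7 {G : Type*} [AddCommGroup G] [Fintype G]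
    (hG : 3 ≤ Fintype.card G) (x : G → ℝ) (hx : InGroupCone x)
    (hpos : ∀ h : G, h ≠ 0 → 0 < x h)
    (y z : G → ℝ) (hy : InGroupCone y) (hz : InGroupCone z)
    (hyeq : ∀ a b : G, coneLe x a b → a ≠ b → y a + y (b - a) = y b)
    (hzeq : ∀ a b : G, coneLe x a b → a ≠ b → z a + z (b - a) = z b)
    (hM : ∀ m : G, m ≠ 0 → (¬ ∃ c : G, c ≠ 0 ∧ c ≠ m ∧ coneLe x c m) →
      y m = z m) :
    y = z := by
  have wf : WellFounded (fun a b : G => x a < x b) := by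
    haveI : IsTrans G (fun a b : G => x a < x b) := ⟨fun _ _ _ h1 h2 => lt_trans h1 h2⟩
    haveI : Std.Irrefl (fun a b : G => x a < x b) := ⟨fun _ h => lt_irrefl _ h⟩
    exact Finite.wellFounded_of_trans_of_irrefl _
  funext b
  induction b using wf.induction with
  | _ b ih =>
    by_cases hb : b = 0
    · rw [hb, hy.1, hz.1]
    by_cases hc : ∃ c : G, c ≠ 0 ∧ c ≠ b ∧ coneLe x c b
    · obtain ⟨c, hc0, hcb, hle⟩ := hc
      have hx2 : x c + x (b - c) = x b := by
        rcases hle with h | h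
        · exact absurd h hcb
        · exact h.2
      have p1 := hpos c hc0
      have p2 := hpos (b - c) (sub_ne_zero.mpr (Ne.symm hcb))
      rw [← hyeq c b hle hcb, ← hzeq c b hle hcb, ih c (by linarith), ih (b - c) (by linarith)]
    · exact hM b hb hc
end

section
/- Let G be a finite abelian group with |G| ≥ 3, let x ∈ C(G) satisfy x(h) > 0 for every nonzero h ∈ G, and let a, b, c ∈ G be nonzero. If x(a) + x(b) = x(a + b) and x(a + b) + x(c) = x(a + b + c), then a + c ≠ 0, x(a) + x(c) = x(a + c), and x(a + c) + x(b) = x(a + b + c). -/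
theorem stmt8 {G : Type*} [AddCommGroup G] [Fintype G]
    (hG : 3 ≤ Fintype.card G) (x : G → ℝ) (hx : InGroupCone x)
    (hpos : ∀ h : G, h ≠ 0 → 0 < x h)
    (a b c : G) (ha : a ≠ 0) (hb : b ≠ 0) (hc : c ≠ 0)
    (h1 : x a + x b = x (a + b)) (h2 : x (a + b) + x c = x (a + b + c)) :
    a + c ≠ 0 ∧ x a + x c = x (a + c) ∧ x (a + c) + x b = x (a + b + c) := by
  obtain ⟨h0, hs⟩ := hx
  have pa := hpos a ha
  have pb := hpos b hb
  have pc := hpos c hc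
  have e : a + c + b = a + b + c := by abel
  have hn : a + b + c ≠ 0 := by
    intro h
    rw [h, h0] at h2
    linarith
  have hac : a + c ≠ 0 := by
    intro h
    rw [← e, h, zero_add] at h2
    linarith
  have i1 := hs a c ha hc hac
  have i2 := hs (a + c) b hac hb (by rw [e]; exact hn)
  rw [e] at i2
  exact ⟨hac, by linarith, by linarith⟩
end

section
/- Let G be a finite abelian group, let x ∈ C(G), let G' ⊆ G be a subgroup of odd order, and let a ∈ G satisfy a ∉ G' and 2a ∉ G'. Then the following are equivalent: (a) there exists b ∈ G' such that x(a + g) + x(a + g + b) = x(2a + 2g + b) for every g ∈ G'; and (b) x(a + g) + x(a + g') = x(2a + g + g') for all g, g' ∈ G'. -/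
theorem stmt9 {G : Type*} [AddCommGroup G] [Fintype G]
    (x : G → ℝ) (hx : InGroupCone x) (G' : AddSubgroup G)
    (hodd : Odd (Nat.card G')) (a : G) (ha : a ∉ G') (h2a : a + a ∉ G') :
    (∃ b ∈ G', ∀ g ∈ G',
        x (a + g) + x (a + g + b) = x (a + g + (a + g) + b)) ↔
    (∀ g ∈ G', ∀ g' ∈ G',
        x (a + g) + x (a + g') = x (a + a + g + g')) := by
  classical
  obtain ⟨h0, hsub⟩ := hx
  constructor
  · rintro ⟨b, hb, hab⟩ g hg g' hg'
    have hcop : (Nat.card G').Coprime 2 := (Nat.coprime_two_right).2 hodd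
    have hA : ∀ c : G', ∑ k : G', x (a + k + c) = ∑ k : G', x (a + k) := by
      intro c
      refine Fintype.sum_equiv (Equiv.addRight c) _ _ ?_
      intro k
      simp [add_assoc]
    have hB : ∀ c : G', ∑ k : G', x (a + k + (a + k) + c) = ∑ k : G', x (a + a + k) := by
      intro c
      refine Fintype.sum_equiv ((nsmulCoprime hcop).trans (Equiv.addRight c)) _ _ ?_
      intro k
      congr 1
      simp [two_nsmul]
      abel
    have hne : ∀ k : G', a + (k : G) ≠ 0 := by
      intro k h
      apply ha
      rw [eq_neg_of_add_eq_zero_left h]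
      exact G'.neg_mem k.2
    have hne2 : ∀ k : G', a + a + (k : G) ≠ 0 := by
      intro k h
      apply h2a
      rw [eq_neg_of_add_eq_zero_left h]
      exact G'.neg_mem k.2
    have hnn : ∀ c k : G', x (a + k + (a + k) + c) ≤ x (a + k) + x (a + k + c) := by
      intro c k
      have e : a + (k : G) + (a + k) + c = (a + k) + (a + k + c) := by abel
      rw [e]
      apply hsub
      · exact hne k
      · have := hne (k + c)
        simpa [add_assoc] using this
      · have := hne2 (k + (k + c))
        intro h
        apply this
        rw [← h]
        push_cast
        abel
    have key : ∑ k : G', x (a + a + k) = ∑ k : G', x (a + k) + ∑ k : G', x (a + k) := by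
      rw [← hB ⟨b, hb⟩]
      nth_rewrite 2 [← hA ⟨b, hb⟩]
      rw [← Finset.sum_add_distrib]
      exact Finset.sum_congr rfl fun k _ => (hab k k.2).symm
    let c : G' := ⟨g' - g, G'.sub_mem hg' hg⟩
    have hs : ∑ k : G', x (a + k + (a + k) + c) = ∑ k : G', (x (a + k) + x (a + k + c)) := by
      rw [Finset.sum_add_distrib, hA, hB, key]
    have := (Finset.sum_eq_sum_iff_of_le (fun k _ => hnn c k)).1 hs ⟨g, hg⟩ (Finset.mem_univ _)
    have e1 : a + g + (g' - g) = a + g' := by abel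
    have e2 : a + g + (a + g) + (g' - g) = a + a + g + g' := by abel
    simp only [c, e1, e2] at this
    exact this.symm
  · intro h
    refine ⟨0, G'.zero_mem, fun g hg => ?_⟩
    have := h g hg g hg
    have e : a + g + (a + g) + 0 = a + a + g + g := by abel
    rw [e, add_zero, this]
end

section
/- Let G be a finite abelian group, let x ∈ C(G), let G' ⊆ G be a subgroup of odd order, and let a ∈ G satisfy a ∉ G' and 2a ∉ G'. Then ∑_{g ∈ G'} 2·x(a + g) ≥ ∑_{g ∈ G'} x(2a + g). -/
theorem stmt10 {G : Type*} [AddCommGroup G] [Fintype G]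
    (x : G → ℝ) (hx : InGroupCone x) (G' : AddSubgroup G)
    (hodd : Odd (Nat.card G')) (a : G) (ha : a ∉ G') (h2a : a + a ∉ G') :
    ∑ᶠ g ∈ (G' : Set G), x (a + a + g) ≤ ∑ᶠ g ∈ (G' : Set G), 2 * x (a + g) := by
  rw [← finsum_set_coe_eq_finsum_mem (f := fun g => x (a + a + g)) (G' : Set G),
    ← finsum_set_coe_eq_finsum_mem (f := fun g => 2 * x (a + g)) (G' : Set G)]
  have : Fintype G' := Fintype.ofFinite _
  have hc : (Nat.card G').Coprime 2 := Nat.coprime_two_right.mpr hodd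
  change ∑ᶠ g : G', x (a + a + g) ≤ ∑ᶠ g : G', 2 * x (a + g)
  rw [finsum_eq_sum_of_fintype, finsum_eq_sum_of_fintype, ← (nsmulCoprime hc).sum_comp]
  refine Finset.sum_le_sum fun g _ => ?_
  have e : a + a + ((nsmulCoprime hc g : G') : G) = (a + g) + (a + g) := by
    rw [nsmulCoprime_apply]
    push_cast
    abel
  have h1 : a + (g : G) ≠ 0 := fun h => ha (by
    rw [eq_neg_of_add_eq_zero_left h]; exact G'.neg_mem g.2)
  have h2 : (a + g) + (a + (g : G)) ≠ 0 := fun h => h2a (by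
    rw [← e] at h
    rw [eq_neg_of_add_eq_zero_left h]; exact G'.neg_mem (Subtype.property _))
  rw [e]
  linarith [hx.2 _ _ h1 h1 h2]
end

section
/- Fix m ≥ 2. The map sending a numerical semigroup S containing m to its Kunz coordinate vector (k_1(S;m), …, k_{m−1}(S;m)), where k_i(S;m) = (a_i(S;m) − i)/m, is a bijection from the set of numerical semigroups S with m ∈ S onto the set of tuples (z_1, …, z_{m−1}) of nonnegative integers satisfying z_i + z_j ≥ z_{i+j} for all 1 ≤ i ≤ j ≤ m−1 with i + j < m, and z_i + z_j + 1 ≥ z_{i+j−m} for all 1 ≤ i ≤ j ≤ m−1 with i + j > m. -/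
/-- A numerical semigroup: an additive submonoid of `ℕ` with finite complement. -/
def IsNumericalSemigroup (S : Set ℕ) : Prop :=
  0 ∈ S ∧ (∀ a ∈ S, ∀ b ∈ S, a + b ∈ S) ∧ (Sᶜ : Set ℕ).Finite

/-- `aElt S m i` is the smallest element of `S` congruent to `i` modulo `m`. -/
noncomputable def aElt (S : Set ℕ) (m i : ℕ) : ℕ :=
  sInf {s | s ∈ S ∧ s % m = i % m}

theorem kunz_mul_mem {S : Set ℕ} {m : ℕ} (hS : IsNumericalSemigroup S) (hmS : m ∈ S) {a : ℕ} (ha : a ∈ S) (q : ℕ) :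
    a + m * q ∈ S := by
  induction q with
  | zero => simpa using ha
  | succ n ih =>
    have := hS.2.1 _ ih _ hmS
    rw [Nat.mul_succ, ← Nat.add_assoc]; exact this

theorem kunz_key {S : Set ℕ} {m : ℕ} (hS : IsNumericalSemigroup S) (hmS : m ∈ S) {r : ℕ} (hr : r < m)
    (q : ℕ) : r + m * q ∈ S ↔ (aElt S m r - r) / m ≤ q := by
  have hm : 0 < m := by omega
  have hne : {s | s ∈ S ∧ s % m = r % m}.Nonempty := by
    obtain ⟨B, hB⟩ := hS.2.2.bddAbove
    refine ⟨r + m * (B + 1), ?_, by simp⟩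
    by_contra h
    have h1 : r + m * (B + 1) ≤ B := hB h
    nlinarith
  obtain ⟨h1, h2⟩ : aElt S m r ∈ S ∧ aElt S m r % m = r % m := Nat.sInf_mem hne
  have h3 : ∀ x ∈ S, x % m = r % m → aElt S m r ≤ x := fun x hx hx' => Nat.sInf_le ⟨hx, hx'⟩
  generalize aElt S m r = a at *
  rw [Nat.mod_eq_of_lt hr] at h2
  have h4 : r + m * (a / m) = a := by rw [← h2]; exact Nat.mod_add_div a m
  have h5 : (a - r) / m = a / m := by
    have : a - r = m * (a / m) := by omega
    rw [this, Nat.mul_div_cancel_left _ hm]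
  rw [h5]
  constructor
  · intro h
    have := h3 _ h (by simp)
    rw [← h4] at this
    exact Nat.le_of_mul_le_mul_left (by omega) hm
  · intro h
    obtain ⟨d, rfl⟩ := Nat.exists_eq_add_of_le h
    have := kunz_mul_mem hS hmS h1 d
    rw [← h4] at this
    rwa [Nat.mul_add, ← Nat.add_assoc]

theorem kunz_surj (m : ℕ) (hm : 2 ≤ m) (w : ℕ → ℕ) (hw0 : w 0 = 0)
    (h1 : ∀ i j, i < m → j < m → i + j < m → w (i + j) ≤ w i + w j)
    (h2 : ∀ i j, i < m → j < m → m ≤ i + j → w (i + j - m) ≤ w i + w j + 1) :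
    IsNumericalSemigroup {x | w (x % m) ≤ x / m} := by
  have hm0 : 0 < m := by omega
  refine ⟨by simp [hw0], ?_, ?_⟩
  · intro a ha b hb
    simp only [Set.mem_setOf_eq] at *
    have ra := Nat.mod_lt a hm0
    have rb := Nat.mod_lt b hm0
    rw [Nat.add_div hm0]
    by_cases h : m ≤ a % m + b % m
    · have := h2 _ _ ra rb h
      rw [if_pos h, Nat.add_mod, Nat.mod_eq_sub_mod h, Nat.mod_eq_of_lt (by omega)]
      omega
    · have := h1 _ _ ra rb (by omega)
      rw [if_neg h, Nat.add_mod, Nat.mod_eq_of_lt (by omega)]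
      omega
  · refine (Set.finite_Iio (m * (∑ i ∈ Finset.range m, w i + 1))).subset ?_
    intro x hx
    simp only [Set.mem_compl_iff, Set.mem_setOf_eq, not_le, Set.mem_Iio] at *
    have h : w (x % m) ≤ ∑ i ∈ Finset.range m, w i :=
      Finset.single_le_sum (f := w) (fun _ _ => Nat.zero_le _) (Finset.mem_range.2 (Nat.mod_lt x hm0))
    rw [Nat.mul_comm]
    exact (Nat.div_lt_iff_lt_mul hm0).1 (by omega)

/-- The Kunz coordinate map `S ↦ (k_1, …, k_{m-1})`, where
`k_i = (a_i(S;m) - i) / m`, is a bijection from numerical semigroups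
containing `m` onto the lattice points of the Kunz polyhedron `P_m`.
Coordinates are indexed by `Fin (m-1)`, with `i : Fin (m-1)` representing
the residue `i + 1 ∈ {1, …, m-1}`. -/
theorem stmt11 (m : ℕ) (hm : 2 ≤ m) :
    Set.BijOn
      (fun S : Set ℕ => fun i : Fin (m - 1) =>
        (aElt S m (i.val + 1) - (i.val + 1)) / m)
      {S : Set ℕ | IsNumericalSemigroup S ∧ m ∈ S}
      {z : Fin (m - 1) → ℕ |
        (∀ i j k : Fin (m - 1), i.val ≤ j.val →
          (i.val + 1) + (j.val + 1) = k.val + 1 → z k ≤ z i + z j) ∧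
        (∀ i j k : Fin (m - 1), i.val ≤ j.val →
          (i.val + 1) + (j.val + 1) = (k.val + 1) + m → z k ≤ z i + z j + 1)} := by
  have hm0 : 0 < m := by omega
  refine ⟨?_, ?_, ?_⟩
  · rintro S ⟨hS, hmS⟩
    refine ⟨?_, ?_⟩
    · intro i j k _ hk
      have hi := (kunz_key hS hmS (r := i.val + 1) (by omega) _).2 le_rfl
      have hj := (kunz_key hS hmS (r := j.val + 1) (by omega) _).2 le_rfl
      refine (kunz_key hS hmS (r := k.val + 1) (by omega) _).1 ?_
      have := hS.2.1 _ hi _ hj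
      convert this using 1
      rw [← hk]; ring
    · intro i j k _ hk
      have hi := (kunz_key hS hmS (r := i.val + 1) (by omega) _).2 le_rfl
      have hj := (kunz_key hS hmS (r := j.val + 1) (by omega) _).2 le_rfl
      refine (kunz_key hS hmS (r := k.val + 1) (by omega) _).1 ?_
      have := hS.2.1 _ hi _ hj
      convert this using 1
      linear_combination -hk
  · rintro S ⟨hS, hmS⟩ T ⟨hT, hmT⟩ h
    ext x
    rw [← Nat.mod_add_div x m]
    have hr := Nat.mod_lt x hm0
    by_cases h0 : x % m = 0
    · rw [h0]
      exact iff_of_true (kunz_mul_mem hS hmS hS.1 _) (kunz_mul_mem hT hmT hT.1 _)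
    · rw [kunz_key hS hmS hr, kunz_key hT hmT hr]
      have := congrFun h ⟨x % m - 1, by omega⟩
      simp only [Nat.sub_add_cancel (Nat.pos_of_ne_zero h0)] at this
      rw [this]
  · rintro z ⟨hz1, hz2⟩
    obtain ⟨w, hw0, hw⟩ : ∃ w : ℕ → ℕ, w 0 = 0 ∧ ∀ i : Fin (m - 1), w (i.val + 1) = z i :=
      ⟨fun r => if h : 0 < r ∧ r - 1 < m - 1 then z ⟨r - 1, h.2⟩ else 0, by simp, fun i => by simp⟩
    have hw' : ∀ r (_ : r ≠ 0) (_ : r < m), ∃ i : Fin (m - 1), i.val + 1 = r ∧ w r = z i := by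
      intro r h0 h
      refine ⟨⟨r - 1, by omega⟩, by simp; omega, ?_⟩
      rw [← hw]; congr 1; simp; omega
    have hN : IsNumericalSemigroup {x | w (x % m) ≤ x / m} := by
      refine kunz_surj m hm w hw0 ?_ ?_
      · intro i j hi hj hij
        by_cases i0 : i = 0
        · subst i0; simp
        by_cases j0 : j = 0
        · subst j0; simp
        obtain ⟨i', ei, wi⟩ := hw' i i0 hi
        obtain ⟨j', ej, wj⟩ := hw' j j0 hj
        obtain ⟨k', ek, wk⟩ := hw' (i + j) (by omega) hij
        rw [wi, wj, wk]
        rcases le_total i'.val j'.val with hl | hl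
        · exact hz1 _ _ _ hl (by omega)
        · rw [add_comm]; exact hz1 _ _ _ hl (by omega)
      · intro i j hi hj hij
        by_cases k0 : i + j - m = 0
        · rw [k0, hw0]; omega
        obtain ⟨i', ei, wi⟩ := hw' i (by omega) hi
        obtain ⟨j', ej, wj⟩ := hw' j (by omega) hj
        obtain ⟨k', ek, wk⟩ := hw' (i + j - m) k0 (by omega)
        rw [wi, wj, wk]
        rcases le_total i'.val j'.val with hl | hl
        · exact hz2 _ _ _ hl (by omega)
        · rw [add_comm (z i')]; exact hz2 _ _ _ hl (by omega)
    have hmN : m ∈ {x | w (x % m) ≤ x / m} := by simp [hw0]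
    refine ⟨_, ⟨hN, hmN⟩, ?_⟩
    funext i
    refine eq_of_forall_ge_iff fun q => ?_
    have hi : i.val + 1 < m := by omega
    rw [← kunz_key hN hmN hi q, Set.mem_setOf_eq, Nat.add_mul_mod_self_left, Nat.mod_eq_of_lt hi,
      Nat.add_mul_div_left _ _ hm0, Nat.div_eq_of_lt hi, zero_add, hw]
end

section
/- Fix m ≥ 2. The map sending a numerical semigroup S to its Kunz coordinate vector (k_1(S;m), …, k_{m−1}(S;m)), where k_i(S;m) = (a_i(S;m) − i)/m, is a bijection from the set of numerical semigroups whose smallest nonzero element equals m onto the set of tuples (z_1, …, z_{m−1}) of integers with z_i ≥ 1 for all i that satisfy z_i + z_j ≥ z_{i+j} for all 1 ≤ i ≤ j ≤ m−1 with i + j < m, and z_i + z_j + 1 ≥ z_{i+j−m} for all 1 ≤ i ≤ j ≤ m−1 with i + j > m. -/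
theorem aux_exists (S : Set ℕ) (m r : ℕ) (hm : 2 ≤ m) (hr : r < m)
    (hS : IsNumericalSemigroup S) (hmS : m ∈ S) :
    ∃ c, ∀ q, m * q + r ∈ S ↔ c ≤ q := by
  classical
  obtain ⟨h0, hadd, hfin⟩ := hS
  have hex : ∃ q, m * q + r ∈ S := by
    by_contra hcon
    push Not at hcon
    have hinj : Function.Injective (fun q : ℕ => m * q + r) := by
      intro a b hab
      have hab' : m * a + r = m * b + r := hab
      exact Nat.eq_of_mul_eq_mul_left (by omega) (Nat.add_right_cancel hab')
    exact (Set.infinite_of_injective_forall_mem hinj (s := Sᶜ) (fun q => hcon q)) hfin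
  refine ⟨Nat.find hex, fun q => ⟨fun h => Nat.find_min' hex h, fun h => ?_⟩⟩
  induction q, h using Nat.le_induction with
  | base => exact Nat.find_spec hex
  | succ n _ ih =>
    have := hadd _ ih _ hmS
    have e : m * (n + 1) + r = m * n + r + m := by ring
    rw [e]; exact this

theorem aux_aElt (S : Set ℕ) (m r c : ℕ) (hm : 2 ≤ m) (hr : r < m)
    (h : ∀ q, m * q + r ∈ S ↔ c ≤ q) : (aElt S m r - r) / m = c := by
  have e : aElt S m r = m * c + r := by
    have hl : IsLeast {s | s ∈ S ∧ s % m = r % m} (m * c + r) := by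
      refine ⟨⟨(h c).2 le_rfl, by simp⟩, ?_⟩
      rintro s ⟨hs, hmod⟩
      rw [Nat.mod_eq_of_lt hr] at hmod
      have hd := Nat.div_add_mod s m
      rw [hmod] at hd
      rw [← hd] at hs ⊢
      have := (h _).1 hs
      gcongr
    exact hl.csInf_eq
  rw [e, Nat.add_sub_cancel, Nat.mul_div_cancel_left _ (by omega)]

theorem aux_key (S : Set ℕ) (m r : ℕ) (hm : 2 ≤ m) (hr : r < m)
    (hS : IsNumericalSemigroup S) (hmS : m ∈ S) (q : ℕ) :
    m * q + r ∈ S ↔ (aElt S m r - r) / m ≤ q := by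
  obtain ⟨c, hc⟩ := aux_exists S m r hm hr hS hmS
  rw [aux_aElt S m r c hm hr hc]
  exact hc q


/-- The Kunz coordinate map `S ↦ (k_1, …, k_{m-1})`, where
`k_i = (a_i(S;m) - i) / m`, is a bijection from numerical semigroups with
multiplicity (smallest nonzero element) equal to `m` onto the lattice points
of the strict Kunz polyhedron `P'_m` (all coordinates at least `1`).
Coordinates are indexed by `Fin (m-1)`, with `i : Fin (m-1)` representing
the residue `i + 1 ∈ {1, …, m-1}`. -/
theorem stmt12 (m : ℕ) (hm : 2 ≤ m) :
    Set.BijOn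
      (fun S : Set ℕ => fun i : Fin (m - 1) =>
        (aElt S m (i.val + 1) - (i.val + 1)) / m)
      {S : Set ℕ | IsNumericalSemigroup S ∧ IsLeast {s ∈ S | s ≠ 0} m}
      {z : Fin (m - 1) → ℕ |
        (∀ i : Fin (m - 1), 1 ≤ z i) ∧
        (∀ i j k : Fin (m - 1), i.val ≤ j.val →
          (i.val + 1) + (j.val + 1) = k.val + 1 → z k ≤ z i + z j) ∧
        (∀ i j k : Fin (m - 1), i.val ≤ j.val →
          (i.val + 1) + (j.val + 1) = (k.val + 1) + m → z k ≤ z i + z j + 1)} := by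

  have hm0 : 0 < m := by omega
  refine ⟨?_, ?_, ?_⟩
  · rintro S ⟨hS, ⟨hmS, -⟩, hmin⟩
    have key := fun (i : Fin (m - 1)) => aux_key S m (i.val + 1) hm (by omega) hS hmS
    refine ⟨fun i => ?_, fun i j k _ h => ?_, fun i j k _ h => ?_⟩
    · by_contra hlt
      have h0 := (key i 0).2 (by simpa using hlt)
      have := hmin ⟨h0, by omega⟩
      omega
    · refine (key k _).1 ?_
      have := hS.2.1 _ ((key i _).2 le_rfl) _ ((key j _).2 le_rfl)
      convert this using 1
      rw [← h]; ring
    · refine (key k _).1 ?_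
      have := hS.2.1 _ ((key i _).2 le_rfl) _ ((key j _).2 le_rfl)
      convert this using 1
      linarith
  · rintro S ⟨hS, ⟨hmS, -⟩, -⟩ T ⟨hT, ⟨hmT, -⟩, -⟩ hST
    have mul : ∀ U : Set ℕ, IsNumericalSemigroup U → m ∈ U → ∀ q, m * q ∈ U := by
      intro U hU hmU q
      induction q with
      | zero => exact hU.1
      | succ n ih => exact hU.2.1 _ ih _ hmU
    ext n
    rw [← Nat.div_add_mod n m]
    have hlt := Nat.mod_lt n hm0
    rcases Nat.eq_zero_or_pos (n % m) with h | h
    · rw [h]; exact ⟨fun _ => mul T hT hmT _, fun _ => mul S hS hmS _⟩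
    · rw [aux_key S m _ hm hlt hS hmS, aux_key T m _ hm hlt hT hmT]
      have := congrFun hST ⟨n % m - 1, by omega⟩
      simp only [Nat.sub_add_cancel h] at this
      rw [this]
  · rintro z ⟨h1, h2, h3⟩
    have h2' : ∀ i j k : Fin (m - 1),
          (i.val + 1) + (j.val + 1) = k.val + 1 → z k ≤ z i + z j := by
      intro i j k h
      rcases le_total i.val j.val with hij | hij
      · exact h2 i j k hij h
      · rw [add_comm]; exact h2 j i k hij (by omega)
    have h3' : ∀ i j k : Fin (m - 1),
          (i.val + 1) + (j.val + 1) = (k.val + 1) + m → z k ≤ z i + z j + 1 := by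
      intro i j k h
      rcases le_total i.val j.val with hij | hij
      · exact h3 i j k hij h
      · rw [add_comm (z i)]; exact h3 j i k hij (by omega)
    let S : Set ℕ := {n | ∀ i : Fin (m - 1), i.val + 1 = n % m → z i ≤ n / m}
    have hkey : ∀ (i : Fin (m - 1)) q, m * q + (i.val + 1) ∈ S ↔ z i ≤ q := by
      intro i q
      have hi : i.val + 1 < m := by omega
      have e1 : (m * q + (i.val + 1)) % m = i.val + 1 := by
        rw [Nat.mul_add_mod, Nat.mod_eq_of_lt hi]
      have e2 : (m * q + (i.val + 1)) / m = q := by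
        rw [Nat.mul_add_div hm0, Nat.div_eq_of_lt hi, add_zero]
      constructor
      · intro h
        have := h i e1.symm
        rwa [e2] at this
      · intro h j hj
        rw [e1] at hj
        have : j = i := Fin.ext (by omega)
        rw [e2, this]; exact h
    refine ⟨S, ⟨⟨?_, ?_, ?_⟩, ⟨?_, ?_⟩, ?_⟩, ?_⟩
    · intro i hi; simp at hi
    · intro a ha b hb k hk
      have la := Nat.mod_lt a hm0
      have lb := Nat.mod_lt b hm0
      have lk := k.isLt
      rcases Nat.eq_zero_or_pos (a % m) with ea | ea
      · have hk2 : k.val + 1 = b % m := by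
          rw [hk, Nat.add_mod, ea, zero_add, Nat.mod_mod]
        exact (hb k hk2).trans (Nat.div_le_div_right (by omega))
      rcases Nat.eq_zero_or_pos (b % m) with eb | eb
      · have hk2 : k.val + 1 = a % m := by
          rw [hk, Nat.add_mod, eb, add_zero, Nat.mod_mod]
        exact (ha k hk2).trans (Nat.div_le_div_right (by omega))
      have za := ha ⟨a % m - 1, by omega⟩ (by simp only; omega)
      have zb := hb ⟨b % m - 1, by omega⟩ (by simp only; omega)
      rw [Nat.add_div hm0]
      rw [Nat.add_mod] at hk
      split_ifs with hc
      · have := h3' ⟨a % m - 1, by omega⟩ ⟨b % m - 1, by omega⟩ k (by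
          rw [Nat.mod_eq_sub_mod hc, Nat.mod_eq_of_lt (by omega)] at hk
          simp only; omega)
        omega
      · have := h2' ⟨a % m - 1, by omega⟩ ⟨b % m - 1, by omega⟩ k (by
          rw [Nat.mod_eq_of_lt (by omega)] at hk
          simp only; omega)
        omega
    · refine (Set.finite_Iio (m * ∑ i, z i)).subset ?_
      intro n hn
      by_contra hge
      refine hn fun i _ => ?_
      have hge' : m * ∑ i, z i ≤ n := by simpa using hge
      refine (Finset.single_le_sum (fun _ _ => Nat.zero_le _) (Finset.mem_univ i)).trans ?_
      rw [Nat.le_div_iff_mul_le hm0, mul_comm]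
      exact hge'
    · intro i hi; simp at hi
    · omega
    · rintro n ⟨hn, hn0⟩
      by_contra hlt
      have hlt' : n < m := by omega
      have := hn ⟨n - 1, by omega⟩ (by rw [Nat.mod_eq_of_lt hlt']; simp only; omega)
      rw [Nat.div_eq_of_lt hlt'] at this
      have := h1 ⟨n - 1, by omega⟩
      omega
    · funext i
      exact aux_aElt S m _ _ hm (by omega) (hkey i)
end

section
/- Fix m ≥ 2 and nonnegative integers z_1, …, z_{m−1} satisfying z_i + z_j ≥ z_{i+j} for all 1 ≤ i ≤ j ≤ m−1 with i + j < m, and z_i + z_j + 1 ≥ z_{i+j−m} for all 1 ≤ i ≤ j ≤ m−1 with i + j > m. Set a_0 = 0 and a_i = z_i·m + i for 1 ≤ i ≤ m−1. Then the set S = {n ∈ ℕ : a_{(n mod m)} ≤ n} is an additive submonoid of ℕ with finite complement (a numerical semigroup), it contains m, and for each i ∈ {1, …, m−1} the smallest element of S congruent to i modulo m equals a_i; in particular the Apéry set of S with respect to m is {0, a_1, …, a_{m−1}}. -/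
/-- Given nonnegative integers `z_1, …, z_{m-1}` satisfying the Kunz
inequalities, setting `a_0 = 0` and `a_i = z_i * m + i`, the set
`S = {n : a_{n mod m} ≤ n}` is a numerical semigroup containing `m`, and for
each `i ∈ {1, …, m-1}` the smallest element of `S` congruent to `i` modulo
`m` is `a_i`; in particular `Ap(S;m) = {0, a_1, …, a_{m-1}}`. -/
theorem stmt15 (m : ℕ) (hm : 2 ≤ m) (z : ℕ → ℕ)
    (hz1 : ∀ i j : ℕ, 1 ≤ i → i ≤ j → j ≤ m - 1 → i + j < m →
      z (i + j) ≤ z i + z j)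
    (hz2 : ∀ i j : ℕ, 1 ≤ i → i ≤ j → j ≤ m - 1 → m < i + j →
      z (i + j - m) ≤ z i + z j + 1)
    (a : ℕ → ℕ) (ha0 : a 0 = 0)
    (ha : ∀ i : ℕ, 1 ≤ i → i ≤ m - 1 → a i = z i * m + i)
    (S : Set ℕ) (hSdef : S = {n : ℕ | a (n % m) ≤ n}) :
    IsNumericalSemigroup S ∧ m ∈ S ∧
      ∀ i : ℕ, 1 ≤ i → i ≤ m - 1 →
        IsLeast {s | s ∈ S ∧ s % m = i % m} (a i) := by
  have key0 : ∀ i j, i ≤ j → j < m → a ((i + j) % m) ≤ a i + a j := by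
    intro i j hij hj
    rcases Nat.eq_zero_or_pos i with rfl | hi
    · simp [ha0, Nat.mod_eq_of_lt hj]
    rw [ha i hi (by omega), ha j (by omega) (by omega)]
    rcases lt_trichotomy (i + j) m with h | h | h
    · rw [Nat.mod_eq_of_lt h, ha (i + j) (by omega) (by omega)]
      have := Nat.mul_le_mul_right m (hz1 i j hi hij (by omega) h)
      rw [add_mul] at this
      omega
    · simp [h, ha0]
    · have e : (i + j) % m = i + j - m := by
        rw [Nat.mod_eq_sub_mod h.le, Nat.mod_eq_of_lt (by omega)]
      rw [e, ha _ (by omega) (by omega)]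
      have := Nat.mul_le_mul_right m (hz2 i j hi hij (by omega) h)
      rw [add_mul, add_mul] at this
      omega
  have key : ∀ i j, i < m → j < m → a ((i + j) % m) ≤ a i + a j := by
    intro i j hi hj
    rcases le_total i j with h | h
    · exact key0 i j h hj
    · have := key0 j i h hi
      rwa [add_comm j i, add_comm (a j)] at this
  have hm0 : 0 < m := by omega
  subst hSdef
  refine ⟨⟨by simp [ha0], ?_, ?_⟩, by simp [ha0], ?_⟩
  · intro x hx y hy
    simp only [Set.mem_setOf_eq] at *
    have := key (x % m) (y % m) (Nat.mod_lt _ hm0) (Nat.mod_lt _ hm0)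
    rw [← Nat.add_mod] at this
    omega
  · apply (Set.finite_Iio (∑ i ∈ Finset.range m, a i)).subset
    intro x hx
    simp only [Set.mem_compl_iff, Set.mem_setOf_eq, not_le, Set.mem_Iio] at *
    exact hx.trans_le (Finset.single_le_sum (f := a) (fun _ _ => Nat.zero_le _)
      (Finset.mem_range.2 (Nat.mod_lt x hm0)))
  · intro i hi1 hi2
    have e : i % m = i := Nat.mod_eq_of_lt (by omega)
    have e2 : a i % m = i := by
      rw [ha i hi1 hi2, Nat.mul_add_mod_self_right, e]
    refine ⟨⟨?_, ?_⟩, ?_⟩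
    · simp [e2]
    · rw [e2, e]
    · rintro s ⟨hs, hs'⟩
      simp only [Set.mem_setOf_eq] at hs
      rwa [hs', e] at hs
end

section
/- Let S be a numerical semigroup, let m ∈ S with m ≥ 2, and let g, h be positive integers with g·h ≡ 1 (mod m). Then there exists a numerical semigroup T with m ∈ T such that for each i ∈ {1, …, m−1}, the smallest element of T congruent to i modulo m equals g · a_{(h·i mod m)}(S;m). -/
/-- If `g·h ≡ 1 (mod m)` with `g, h` positive, then there is a numerical
semigroup `T` containing `m` whose Apéry set elements are
`a_i(T;m) = g · a_{(h·i mod m)}(S;m)`. -/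
theorem stmt16 (S : Set ℕ) (hS : IsNumericalSemigroup S)
    (m : ℕ) (hm : 2 ≤ m) (hmS : m ∈ S)
    (g h : ℕ) (hg : 0 < g) (hh : 0 < h) (hgh : g * h % m = 1 % m) :
    ∃ T : Set ℕ, IsNumericalSemigroup T ∧ m ∈ T ∧
      ∀ i : ℕ, 1 ≤ i → i ≤ m - 1 →
        IsLeast {t | t ∈ T ∧ t % m = i % m} (g * aElt S m (h * i % m)) := by
  obtain ⟨h0, hadd, hfin⟩ := hS
  obtain ⟨N, hN⟩ := hfin.bddAbove
  have hbig : ∀ n, N < n → n ∈ S := by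
    intro n hn
    by_contra hc
    exact absurd (hN hc) (by omega)
  have hgh' : g * h ≡ 1 [MOD m] := hgh
  have hmem : ∀ r, (N + 1) * m + r ∈ S := by
    intro r
    apply hbig
    nlinarith
  have hmod : ∀ r, (N + 1) * m + r ≡ r [MOD m] := by
    intro r
    simp [Nat.ModEq]
  have hinv : ∀ x, g * (h * x) ≡ x [MOD m] := by
    intro x
    have := hgh'.mul_right x
    rwa [one_mul, mul_assoc] at this
  refine ⟨{t | ∃ s ∈ S, ∃ k, t = g * s + k * m}, ⟨⟨0, h0, 0, by simp⟩, ?_, ?_⟩,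
    ⟨0, h0, 1, by simp⟩, ?_⟩
  · rintro a ⟨s, hs, k, rfl⟩ b ⟨s', hs', k', rfl⟩
    exact ⟨s + s', hadd _ hs _ hs', k + k', by ring⟩
  · apply (Set.finite_lt_nat (g * ((N + 1) * m + m))).subset
    intro t ht
    by_contra hc
    apply ht
    have hc' : g * ((N + 1) * m + m) ≤ t := not_lt.mp hc
    have hlt : h * t % m < m := Nat.mod_lt _ (by omega)
    have hle : g * ((N + 1) * m + h * t % m) ≤ t :=
      le_trans (Nat.mul_le_mul_left _ (by omega)) hc'
    have hcong : g * ((N + 1) * m + h * t % m) ≡ t [MOD m] :=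
      (((hmod _).trans (Nat.mod_modEq _ _)).mul_left g).trans (hinv t)
    obtain ⟨k, hk⟩ := (Nat.modEq_iff_dvd' hle).mp hcong
    refine ⟨_, hmem (h * t % m), k, ?_⟩
    rw [mul_comm k m]
    omega
  · intro i _ _
    have hne : {s | s ∈ S ∧ s % m = (h * i % m) % m}.Nonempty :=
      ⟨_, hmem (h * i % m), hmod _⟩
    obtain ⟨ha, hb⟩ := Nat.sInf_mem hne
    refine ⟨⟨⟨_, ha, 0, by simp [aElt]⟩, ?_⟩, ?_⟩
    · have hb' : aElt S m (h * i % m) ≡ h * i [MOD m] :=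
        Nat.ModEq.trans hb (Nat.mod_modEq _ _)
      exact (hb'.mul_left g).trans (hinv i)
    · rintro t ⟨⟨s, hs, k, rfl⟩, ht⟩
      have h1 : g * s ≡ i [MOD m] := by
        have : g * s + k * m ≡ i [MOD m] := ht
        simpa [Nat.ModEq] using this
      have h2 : s ≡ h * i [MOD m] := by
        have h3 := h1.mul_left h
        have h4 := hinv s
        rw [mul_left_comm] at h4
        exact h4.symm.trans h3
      have h5 : aElt S m (h * i % m) ≤ s :=
        Nat.sInf_le ⟨hs, h2.trans (Nat.mod_modEq _ _).symm⟩
      exact le_trans (Nat.mul_le_mul_left g h5) (Nat.le_add_right _ _)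
end

section
/- Fix n ≥ 2. Let O_n' = {(y_2, …, y_n) ∈ ℝ^{n−1} : (0, y_2, …, y_n) ∈ O_n}. Then the linear map (y_2, …, y_n) ↦ (x_1, …, x_{n−1}) defined by x_1 = y_n/n and x_i = (i/n)·y_n − y_i for 2 ≤ i ≤ n−1 restricts to a bijection from O_n' onto the group cone C(ℤ_n) = {(x_1, …, x_{n−1}) ∈ ℝ^{n−1} : x_i + x_j ≥ x_{(i+j) mod n} for all 1 ≤ i, j ≤ n−1 with i + j ≢ 0 (mod n)}. -/
/-- Membership in the oversemigroup cone `O_n ⊂ ℝ^n`: points are encoded as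
functions `ℕ → ℝ`, with only the coordinates `1, …, n` involved. -/
def InOversCone (n : ℕ) (y : ℕ → ℝ) : Prop :=
  (∀ i j : ℕ, 1 ≤ i → i ≤ j → j ≤ n - 1 → i + j < n →
    y i + y j ≤ y (i + j)) ∧
  (∀ i j : ℕ, 1 ≤ i → i ≤ j → j ≤ n - 1 → n < i + j →
    y i + y j ≤ y (i + j - n) + y n)

/-- The linear map `(y_2, …, y_n) ↦ (x_1, …, x_{n-1})` with `x_1 = y_n/n` and
`x_i = (i/n)·y_n - y_i` maps `O_n' = O_n ∩ {y_1 = 0}` bijectively onto the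
group cone `C(ℤ_n)`.  Points of `O_n'` (resp. `C(ℤ_n)`) are encoded as
functions `ℕ → ℝ` supported on coordinates `2, …, n` (resp. `1, …, n-1`);
note the support condition forces `y 1 = 0`, so `x_1 = (1/n)·y_n - y_1 = y_n/n`. -/
theorem stmt19 (n : ℕ) (hn : 2 ≤ n) :
    Set.BijOn
      (fun y : ℕ → ℝ => fun i : ℕ =>
        if 1 ≤ i ∧ i ≤ n - 1 then (i : ℝ) / n * y n - y i else 0)
      {y : ℕ → ℝ | (∀ i : ℕ, ¬(2 ≤ i ∧ i ≤ n) → y i = 0) ∧ InOversCone n y}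
      {x : ℕ → ℝ | (∀ i : ℕ, ¬(1 ≤ i ∧ i ≤ n - 1) → x i = 0) ∧
        (∀ i j : ℕ, 1 ≤ i → i ≤ n - 1 → 1 ≤ j → j ≤ n - 1 → (i + j) % n ≠ 0 →
          x ((i + j) % n) ≤ x i + x j)} := by
  have hn0 : (n : ℝ) ≠ 0 := by
    have : n ≠ 0 := by omega
    exact_mod_cast this
  refine ⟨?_, ?_, ?_⟩
  · rintro y ⟨hy0, hy1, hy2⟩
    refine ⟨fun i hi => if_neg hi, ?_⟩
    -- symmetric versions
    have h1 : ∀ i j : ℕ, 1 ≤ i → 1 ≤ j → i + j < n → y i + y j ≤ y (i + j) := by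
      intro i j hi hj hij
      rcases le_total i j with h | h
      · exact hy1 i j hi h (by omega) hij
      · have := hy1 j i hj h (by omega) (by omega)
        rw [add_comm j i] at this
        linarith
    have h2 : ∀ i j : ℕ, 1 ≤ i → i ≤ n - 1 → 1 ≤ j → j ≤ n - 1 → n < i + j →
        y i + y j ≤ y (i + j - n) + y n := by
      intro i j hi hi' hj hj' hij
      rcases le_total i j with h | h
      · exact hy2 i j hi h hj' hij
      · have := hy2 j i hj h hi' (by omega)
        rw [add_comm j i] at this
        linarith
    intro i j hi hi' hj hj' hij
    have hlt : (i + j) % n < n := Nat.mod_lt _ (by omega)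
    simp only []
    rw [if_pos ⟨by omega, by omega⟩, if_pos ⟨hi, hi'⟩, if_pos ⟨hj, hj'⟩]
    rcases lt_trichotomy (i + j) n with h | h | h
    · rw [Nat.mod_eq_of_lt h]
      have := h1 i j hi hj h
      push_cast
      have e : ((i : ℝ) + j) / n * y n = (i : ℝ) / n * y n + (j : ℝ) / n * y n := by ring
      linarith
    · exact absurd (by rw [h, Nat.mod_self]) hij
    · have hm : (i + j) % n = i + j - n := by
        rw [Nat.mod_eq_sub_mod h.le, Nat.mod_eq_of_lt (by omega)]
      rw [hm]
      have := h2 i j hi hi' hj hj' h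
      rw [Nat.cast_sub h.le]
      push_cast
      have e : ((i : ℝ) + j - n) / n * y n
          = (i : ℝ) / n * y n + (j : ℝ) / n * y n - y n := by
        field_simp
      linarith
  · rintro y ⟨hy0, -⟩ z ⟨hz0, -⟩ h
    have hi : ∀ i, 1 ≤ i → i ≤ n - 1 → (i : ℝ) / n * y n - y i = (i : ℝ) / n * z n - z i := by
      intro i h1 h2
      have := congrFun h i
      simpa only [if_pos (And.intro h1 h2)] using this
    have hN : y n = z n := by
      have := hi 1 le_rfl (by omega)
      rw [hy0 1 (by omega), hz0 1 (by omega)] at this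
      field_simp at this
      simpa using this
    funext i
    by_cases hc : 2 ≤ i ∧ i ≤ n
    · rcases Nat.lt_or_ge i n with h' | h'
      · have := hi i (by omega) (by omega)
        rw [hN] at this
        linarith
      · have : i = n := by omega
        rw [this, hN]
    · rw [hy0 i hc, hz0 i hc]
  · rintro x ⟨hx0, hx⟩
    let y : ℕ → ℝ := fun i => if 2 ≤ i ∧ i ≤ n then (i : ℝ) * x 1 - x i else 0
    have hy : ∀ i, 1 ≤ i → i ≤ n → y i = (i : ℝ) * x 1 - x i := by
      intro i h1 h2
      by_cases hc : 2 ≤ i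
      · exact if_pos ⟨hc, h2⟩
      · have : i = 1 := by omega
        subst this
        simp [y]
    have hxn : x n = 0 := hx0 n (by omega)
    refine ⟨y, ⟨fun i hi => if_neg hi, ?_, ?_⟩, ?_⟩
    · intro i j hi hij hj h
      have := hx i j hi (by omega) (by omega) hj (by rw [Nat.mod_eq_of_lt h]; omega)
      rw [Nat.mod_eq_of_lt h] at this
      rw [hy i hi (by omega), hy j (by omega) (by omega), hy (i + j) (by omega) (by omega)]
      push_cast
      linarith
    · intro i j hi hij hj h
      have hm : (i + j) % n = i + j - n := by
        rw [Nat.mod_eq_sub_mod h.le, Nat.mod_eq_of_lt (by omega)]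
      have := hx i j hi (by omega) (by omega) hj (by rw [hm]; omega)
      rw [hm] at this
      rw [hy i hi (by omega), hy j (by omega) (by omega), hy (i + j - n) (by omega) (by omega),
        hy n (by omega) le_rfl, Nat.cast_sub h.le, hxn]
      push_cast
      linarith
    · funext i
      by_cases hc : 1 ≤ i ∧ i ≤ n - 1
      · simp only [if_pos hc]
        rw [hy n (by omega) le_rfl, hy i hc.1 (by omega), hxn]
        field_simp
        ring
      · simp only [if_neg hc]
        exact (hx0 i hc).symm
end
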